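/- arXiv:1504.03975 — 2 statements merged into one kernel-verified Lean document; each statement's English description precedes it below -/
import Mathlib

section
/- For every integer k ≥ 2, every ε > 0 and every finite set Ω there is δ = δ(ε,k,Ω) > 0 such that for all sufficiently large n the following holds. Suppose μ ∈ P(Ω^n) is δ-regular with respect to a partition V = (V₁,…,V_m) of [n], and set μ̄_i(·) = ⟨σ[·|V_i]⟩_μ for i ∈ [m]. If Σ_{i=1}^m (|V_i|/n) ⟨‖σ[·|V_i] − μ̄_i‖_TV⟩_μ < δ, then μ is (ε,k)-symmetric. -/
open Finset

noncomputable section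

/-- `μ` is a probability mass function on the finite type `X`. -/
def IsPMF {X : Type*} [Fintype X] (μ : X → ℝ) : Prop :=
  (∀ x, 0 ≤ μ x) ∧ ∑ x, μ x = 1

/-- Total variation distance between two mass functions (half the `L¹` distance,
so that `‖ν − ν'‖_TV = max_A |ν(A) − ν'(A)|` for probability measures). -/
def tv {X : Type*} [Fintype X] (p q : X → ℝ) : ℝ :=
  (∑ x, |p x - q x|) / 2

/-- Expectation `⟨f⟩_μ` of `f` under `μ`. -/
def expec {X : Type*} [Fintype X] (μ : X → ℝ) (f : X → ℝ) : ℝ :=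
  ∑ x, μ x * f x

/-- Mass `μ(S)` of a finite set `S`. -/
def mass {X : Type*} (μ : X → ℝ) (S : Finset X) : ℝ :=
  ∑ x ∈ S, μ x

/-- The conditional measure `μ[·|S]`. -/
def condPMF {X : Type*} [DecidableEq X] (μ : X → ℝ) (S : Finset X) (x : X) : ℝ :=
  if x ∈ S then μ x / mass μ S else 0

/-- The conditional expectation `⟨f | S⟩_μ`. -/
def condExpect {X : Type*} (μ : X → ℝ) (S : Finset X) (f : X → ℝ) : ℝ :=
  (∑ x ∈ S, μ x * f x) / mass μ S

/-- Empirical distribution `σ[·|S]` of the values of `σ` on `S`. -/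
def empDist {V Ω : Type*} [DecidableEq Ω] (σ : V → Ω) (S : Finset V) (ω : Ω) : ℝ :=
  ((S.filter fun x => σ x = ω).card : ℝ) / (S.card : ℝ)

/-- The marginal law `μ_↓x` of the coordinate `x` under `μ ∈ P(Ω^n)`. -/
def marg1 {Ω : Type*} [Fintype Ω] [DecidableEq Ω] {n : ℕ} (μ : (Fin n → Ω) → ℝ)
    (x : Fin n) (ω : Ω) : ℝ :=
  ∑ σ ∈ Finset.univ.filter (fun σ : Fin n → Ω => σ x = ω), μ σ

/-- The joint law `μ_↓(x₁,…,x_k)` of the coordinates `xs` under `μ ∈ P(Ω^n)`. -/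
def margLaw {Ω : Type*} [Fintype Ω] [DecidableEq Ω] {n k : ℕ} (μ : (Fin n → Ω) → ℝ)
    (xs : Fin k → Fin n) (τ : Fin k → Ω) : ℝ :=
  ∑ σ ∈ Finset.univ.filter (fun σ : Fin n → Ω => ∀ i, σ (xs i) = τ i), μ σ

/-- The joint law `μ_↓(x,y)` of a pair of coordinates under `μ ∈ P(Ω^n)`. -/
def pairLaw {Ω : Type*} [Fintype Ω] [DecidableEq Ω] {n : ℕ} (μ : (Fin n → Ω) → ℝ)
    (x y : Fin n) (τ : Ω × Ω) : ℝ :=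
  ∑ σ ∈ Finset.univ.filter (fun σ : Fin n → Ω => σ x = τ.1 ∧ σ y = τ.2), μ σ

/-- `(1/n^k) Σ_{x₁,…,x_k} ‖μ_↓(x₁,…,x_k) − μ_↓x₁ ⊗ ⋯ ⊗ μ_↓x_k‖_TV`. -/
def stateSum {Ω : Type*} [Fintype Ω] [DecidableEq Ω] {n : ℕ} (k : ℕ)
    (μ : (Fin n → Ω) → ℝ) : ℝ :=
  (1 / (n : ℝ) ^ k) * ∑ xs : Fin k → Fin n,
    tv (margLaw μ xs) (fun τ : Fin k → Ω => ∏ i, marg1 μ (xs i) (τ i))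

/-- `S` is an `(ε,k)`-state of `μ`. -/
def IsState {Ω : Type*} [Fintype Ω] [DecidableEq Ω] {n : ℕ} (ε : ℝ) (k : ℕ)
    (μ : (Fin n → Ω) → ℝ) (S : Finset (Fin n → Ω)) : Prop :=
  0 < mass μ S ∧ stateSum k (condPMF μ S) < ε

/-- `μ` is `(ε,k)`-symmetric. -/
def IsSymmetric {Ω : Type*} [Fintype Ω] [DecidableEq Ω] {n : ℕ} (ε : ℝ) (k : ℕ)
    (μ : (Fin n → Ω) → ℝ) : Prop :=
  stateSum k μ < ε

/-- A partition of a type `X` into finitely many nonempty finite classes. -/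
structure FinPartition (X : Type*) where
  k : ℕ
  part : Fin k → Finset X
  nonempty : ∀ i, (part i).Nonempty
  disj : ∀ i j, i ≠ j → Disjoint (part i) (part j)
  covers : ∀ x, ∃ i, x ∈ part i

/-- `W` refines `V`: every class of `W` is contained in a class of `V`. -/
def FinPartition.Refines {X : Type*} (W V : FinPartition X) : Prop :=
  ∀ i, ∃ j, W.part i ⊆ V.part j

/-- `μ` is `ε`-regular on the set `U ⊆ [n]`. -/
def regularOn {Ω : Type*} [Fintype Ω] [DecidableEq Ω] {n : ℕ} (ε : ℝ)
    (μ : (Fin n → Ω) → ℝ) (U : Finset (Fin n)) : Prop :=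
  ∀ S ⊆ U, ε * (U.card : ℝ) ≤ (S.card : ℝ) →
    expec μ (fun σ => tv (empDist σ S) (empDist σ U)) < ε

/-- `μ` is `ε`-regular with respect to a partition `V` of `[n]`. -/
def regularPart {Ω : Type*} [Fintype Ω] [DecidableEq Ω] {n : ℕ} (ε : ℝ)
    (μ : (Fin n → Ω) → ℝ) (V : FinPartition (Fin n)) : Prop :=
  ∃ J : Finset (Fin V.k),
    (∑ i ∈ Finset.univ \ J, ((V.part i).card : ℝ)) < ε * n ∧
    ∀ i ∈ J, regularOn ε μ (V.part i)

/-- `μ` is `ε`-homogeneous with respect to `(V, S)`. -/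
def homogeneous {Ω : Type*} [Fintype Ω] [DecidableEq Ω] {n : ℕ} (ε : ℝ)
    (μ : (Fin n → Ω) → ℝ) (V : FinPartition (Fin n)) (S : FinPartition (Fin n → Ω)) : Prop :=
  ∃ I : Finset (Fin S.k),
    (∀ i ∈ I, 0 < mass μ (S.part i)) ∧
    (∑ i ∈ Finset.univ \ I, mass μ (S.part i)) < ε ∧
    (∀ i : Fin S.k, ∀ j : Fin V.k, ∀ σ ∈ S.part i, ∀ σ' ∈ S.part i,
       tv (empDist σ (V.part j)) (empDist σ' (V.part j)) < ε) ∧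
    (∀ i ∈ I, regularPart ε (condPMF μ (S.part i)) V) ∧
    regularPart ε μ V

/-- The index `ind_μ(V)` of `μ` with respect to the partition `V`. -/
def muIndex {Ω : Type*} [Fintype Ω] [DecidableEq Ω] {n : ℕ}
    (μ : (Fin n → Ω) → ℝ) (V : FinPartition (Fin n)) : ℝ :=
  (1 / ((Fintype.card Ω : ℝ) * n)) * ∑ ω : Ω, ∑ j : Fin V.k, ∑ x ∈ V.part j,
    expec μ (fun σ => ((if σ x = ω then (1 : ℝ) else 0) - empDist σ (V.part j) ω) ^ 2)

/-- The product measure `μ ⊗ μ`, regarded as a measure on `(Ω × Ω)^n`. -/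
def tensorPMF {Ω : Type*} {n : ℕ} (μ : (Fin n → Ω) → ℝ) : (Fin n → Ω × Ω) → ℝ :=
  fun σ => μ (fun i => (σ i).1) * μ (fun i => (σ i).2)

/-- The `n`-fold product `p^{⊗n}` of `p ∈ P(Ω)`. -/
def productPMF {Ω : Type*} [Fintype Ω] {n : ℕ} (p : Ω → ℝ) : (Fin n → Ω) → ℝ :=
  fun σ => ∏ i, p (σ i)

/-- Entropy `H(q)` of a mass function. -/
def entropy {X : Type*} [Fintype X] (q : X → ℝ) : ℝ :=
  -∑ x, q x * Real.log (q x)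

/-- Kullback–Leibler divergence `KL(ν‖μ)`. -/
def klDiv {X : Type*} [Fintype X] (ν μ : X → ℝ) : ℝ :=
  ∑ x, ν x * Real.log (ν x / μ x)

/-- The `j`-th marginal `q_↓j` of `q ∈ P(Ω^d)`. -/
def margOf {Ω : Type*} [Fintype Ω] [DecidableEq Ω] {d : ℕ} (q : (Fin d → Ω) → ℝ)
    (j : Fin d) (ω : Ω) : ℝ :=
  ∑ τ ∈ Finset.univ.filter (fun τ : Fin d → Ω => τ j = ω), q τ

/-- Indicator of `σ x = ω`. -/
def indX {Ω : Type*} [DecidableEq Ω] {n : ℕ} (x : Fin n) (ω : Ω) (σ : Fin n → Ω) : ℝ :=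
  if σ x = ω then 1 else 0

theorem indX_nonneg {Ω : Type*} [DecidableEq Ω] {n : ℕ} (x : Fin n) (ω : Ω) (σ : Fin n → Ω) :
    0 ≤ indX x ω σ := by
  unfold indX; split_ifs <;> norm_num

theorem indX_le {Ω : Type*} [DecidableEq Ω] {n : ℕ} (x : Fin n) (ω : Ω) (σ : Fin n → Ω) :
    indX x ω σ ≤ 1 := by
  unfold indX; split_ifs <;> norm_num

theorem emp_nonneg {V Ω : Type*} [DecidableEq Ω] (σ : V → Ω) (S : Finset V) (ω : Ω) :
    0 ≤ empDist σ S ω := by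
  unfold empDist; positivity

theorem emp_le {V Ω : Type*} [DecidableEq Ω] (σ : V → Ω) (S : Finset V) (ω : Ω) :
    empDist σ S ω ≤ 1 := by
  unfold empDist
  apply div_le_one_of_le₀ _ (by positivity)
  exact_mod_cast Finset.card_filter_le _ _

theorem sum_indX {Ω : Type*} [DecidableEq Ω] {n : ℕ} (S : Finset (Fin n)) (ω : Ω)
    (σ : Fin n → Ω) : ∑ x ∈ S, indX x ω σ = S.card * empDist σ S ω := by
  unfold indX empDist
  rw [Finset.sum_boole]
  rcases S.eq_empty_or_nonempty with rfl | h
  · simp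
  · have : (S.card : ℝ) ≠ 0 := by exact_mod_cast h.card_pos.ne'
    field_simp

theorem le_two_tv {X : Type*} [Fintype X] (p q : X → ℝ) (x : X) : |p x - q x| ≤ 2 * tv p q := by
  unfold tv
  have := Finset.single_le_sum (f := fun x => |p x - q x|) (fun i _ => abs_nonneg _)
    (Finset.mem_univ x)
  linarith

theorem expec_mono {X : Type*} [Fintype X] {μ : X → ℝ} (hμ : IsPMF μ) {f g : X → ℝ}
    (h : ∀ x, f x ≤ g x) : expec μ f ≤ expec μ g := by
  unfold expec
  exact Finset.sum_le_sum fun x _ => mul_le_mul_of_nonneg_left (h x) (hμ.1 x)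

theorem expec_const {X : Type*} [Fintype X] {μ : X → ℝ} (hμ : IsPMF μ) (c : ℝ) :
    expec μ (fun _ => c) = c := by
  unfold expec
  rw [← Finset.sum_mul, hμ.2, one_mul]

theorem expec_smul {X : Type*} [Fintype X] (μ : X → ℝ) (c : ℝ) (f : X → ℝ) :
    expec μ (fun x => c * f x) = c * expec μ f := by
  unfold expec
  rw [Finset.mul_sum]
  exact Finset.sum_congr rfl fun x _ => by ring

theorem expec_add {X : Type*} [Fintype X] (μ : X → ℝ) (f g : X → ℝ) :
    expec μ (fun x => f x + g x) = expec μ f + expec μ g := by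
  unfold expec
  rw [← Finset.sum_add_distrib]
  exact Finset.sum_congr rfl fun x _ => by ring

theorem expec_sum {X ι : Type*} [Fintype X] (μ : X → ℝ) (S : Finset ι) (f : ι → X → ℝ) :
    ∑ i ∈ S, expec μ (f i) = expec μ (fun x => ∑ i ∈ S, f i x) := by
  unfold expec
  rw [Finset.sum_comm]
  exact Finset.sum_congr rfl fun x _ => by rw [Finset.mul_sum]

theorem abs_expec_mul_le {X : Type*} [Fintype X] {μ : X → ℝ} (hμ : IsPMF μ) (f g : X → ℝ)
    (hg : ∀ x, |g x| ≤ 1) : |expec μ (fun x => f x * g x)| ≤ expec μ (fun x => |f x|) := by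
  unfold expec
  refine (Finset.abs_sum_le_sum_abs _ _).trans (Finset.sum_le_sum fun x _ => ?_)
  rw [abs_mul, abs_mul, abs_of_nonneg (hμ.1 x)]
  exact mul_le_mul_of_nonneg_left (mul_le_of_le_one_right (abs_nonneg _) (hg x)) (hμ.1 x)

theorem sum_abs_le_two {ι : Type*} [DecidableEq ι] (U : Finset ι) (f : ι → ℝ) (B : ℝ)
    (h : ∀ S ⊆ U, |∑ x ∈ S, f x| ≤ B) : ∑ x ∈ U, |f x| ≤ 2 * B := by
  rw [← Finset.sum_filter_add_sum_filter_not U (fun x => 0 ≤ f x)]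
  have h1 := h _ (Finset.filter_subset (fun x => 0 ≤ f x) U)
  have h2 := h _ (Finset.filter_subset (fun x => ¬ 0 ≤ f x) U)
  have e1 : ∑ x ∈ U with 0 ≤ f x, |f x| = ∑ x ∈ U with 0 ≤ f x, f x :=
    Finset.sum_congr rfl fun x hx => abs_of_nonneg (Finset.mem_filter.1 hx).2
  have e2 : ∑ x ∈ U with ¬ 0 ≤ f x, |f x| = - ∑ x ∈ U with ¬ 0 ≤ f x, f x := by
    rw [← Finset.sum_neg_distrib]
    exact Finset.sum_congr rfl fun x hx => abs_of_neg (not_le.1 (Finset.mem_filter.1 hx).2)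
  rw [e1, e2]
  have := (abs_le.1 h1).2
  have := (abs_le.1 h2).1
  linarith

section
variable {Ω : Type} [Fintype Ω] [DecidableEq Ω] {n : ℕ}

theorem reg_sub {μ : (Fin n → Ω) → ℝ} (hμ : IsPMF μ) {δ : ℝ} (hδ : 0 < δ)
    {U : Finset (Fin n)} (hU : regularOn δ μ U) (ω : Ω) (g : (Fin n → Ω) → ℝ)
    (hg : ∀ σ, |g σ| ≤ 1) (S : Finset (Fin n)) (hS : S ⊆ U) :
    |∑ x ∈ S, expec μ (fun σ => (indX x ω σ - empDist σ U ω) * g σ)| ≤ 2 * δ * U.card := by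
  have e : ∀ σ : Fin n → Ω, ∑ x ∈ S, (indX x ω σ - empDist σ U ω) * g σ =
      (S.card * (empDist σ S ω - empDist σ U ω)) * g σ := by
    intro σ
    rw [← Finset.sum_mul, Finset.sum_sub_distrib, sum_indX]
    simp; left; ring
  rw [expec_sum]
  simp only [e]
  refine (abs_expec_mul_le hμ _ g hg).trans ?_
  have hc : (S.card : ℝ) ≤ U.card := by exact_mod_cast Finset.card_le_card hS
  have hn : (0:ℝ) ≤ S.card := by positivity
  simp only [abs_mul, abs_of_nonneg hn]
  rw [expec_smul]
  by_cases hb : δ * (U.card : ℝ) ≤ S.card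
  · have h1 := hU S hS hb
    have h2 : expec μ (fun σ => |empDist σ S ω - empDist σ U ω|) ≤ 2 * δ := by
      refine (expec_mono hμ fun σ => le_two_tv (empDist σ S) (empDist σ U) ω).trans ?_
      rw [expec_smul]; linarith
    calc _ ≤ (S.card : ℝ) * (2 * δ) := mul_le_mul_of_nonneg_left h2 hn
      _ ≤ U.card * (2 * δ) := mul_le_mul_of_nonneg_right hc (by positivity)
      _ = _ := by ring
  · have h2 : expec μ (fun σ => |empDist σ S ω - empDist σ U ω|) ≤ 1 := by
      refine (expec_mono hμ (g := fun _ => 1) fun σ => ?_).trans (expec_const hμ 1).le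
      have := emp_nonneg σ S ω
      have := emp_nonneg σ U ω
      have := emp_le σ S ω
      have := emp_le σ U ω
      rw [abs_le]; constructor <;> linarith
    push Not at hb
    have : (S.card : ℝ) * expec μ (fun σ => |empDist σ S ω - empDist σ U ω|) ≤ S.card * 1 :=
      mul_le_mul_of_nonneg_left h2 hn
    have : 0 ≤ δ * U.card := by positivity
    linarith

theorem sum_parts (V : FinPartition (Fin n)) (F : Fin n → ℝ) :
    ∑ x, F x = ∑ i, ∑ x ∈ V.part i, F x := by
  rw [← Finset.sum_biUnion]
  · apply Finset.sum_congr _ fun _ _ => rfl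
    ext x
    simpa using V.covers x
  · intro i _ j _ h
    exact V.disj i j h

theorem card_parts (V : FinPartition (Fin n)) : ∑ i, ((V.part i).card : ℝ) = n := by
  have := sum_parts V (fun _ => 1)
  simpa using this.symm

theorem part_bound {μ : (Fin n → Ω) → ℝ} (hμ : IsPMF μ) {δ : ℝ} (hδ : 0 < δ)
    (V : FinPartition (Fin n)) (hV : regularPart δ μ V) (ω : Ω) (g : (Fin n → Ω) → ℝ)
    (hg : ∀ σ, |g σ| ≤ 1) :
    ∑ i, ∑ x ∈ V.part i, |expec μ (fun σ => (indX x ω σ - empDist σ (V.part i) ω) * g σ)|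
      ≤ 5 * δ * n := by
  obtain ⟨J, hJ, hr⟩ := hV
  rw [← Finset.sum_sdiff (Finset.subset_univ J)]
  have h1 : ∑ i ∈ univ \ J, ∑ x ∈ V.part i,
      |expec μ (fun σ => (indX x ω σ - empDist σ (V.part i) ω) * g σ)|
      ≤ ∑ i ∈ univ \ J, ((V.part i).card : ℝ) := by
    refine Finset.sum_le_sum fun i _ => ?_
    have : ∀ x ∈ V.part i,
        |expec μ (fun σ => (indX x ω σ - empDist σ (V.part i) ω) * g σ)| ≤ 1 := by
      intro x _
      refine (abs_expec_mul_le hμ _ g hg).trans ?_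
      refine (expec_mono hμ (g := fun _ => 1) fun σ => ?_).trans (expec_const hμ 1).le
      have := emp_nonneg σ (V.part i) ω
      have := emp_le σ (V.part i) ω
      have := indX_nonneg x ω σ
      have := indX_le x ω σ
      rw [abs_le]; constructor <;> linarith
    simpa using Finset.sum_le_sum this
  have h2 : ∑ i ∈ J, ∑ x ∈ V.part i,
      |expec μ (fun σ => (indX x ω σ - empDist σ (V.part i) ω) * g σ)|
      ≤ ∑ i, 2 * (2 * δ * ((V.part i).card : ℝ)) := by
    refine (Finset.sum_le_sum fun i hi => sum_abs_le_two _ _ _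
      fun S hS => reg_sub hμ hδ (hr i hi) ω g hg S hS).trans ?_
    exact Finset.sum_le_sum_of_subset_of_nonneg (Finset.subset_univ J)
      fun i _ _ => by positivity
  rw [← Finset.mul_sum, ← Finset.mul_sum, card_parts] at h2
  linarith

theorem mean_bound {μ : (Fin n → Ω) → ℝ} (hμ : IsPMF μ) (hn : 0 < n) {δ : ℝ} (hδ : 0 < δ)
    (V : FinPartition (Fin n)) (hV : regularPart δ μ V)
    (hc : ∑ i : Fin V.k, ((V.part i).card : ℝ) / n *
              expec μ (fun σ => tv (empDist σ (V.part i))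
                (fun ω => expec μ (fun σ' => empDist σ' (V.part i) ω))) < δ)
    (ω : Ω) (g : (Fin n → Ω) → ℝ) (hg : ∀ σ, |g σ| ≤ 1) :
    ∑ i, ∑ x ∈ V.part i, |expec μ (fun σ =>
      (indX x ω σ - expec μ (fun σ' => empDist σ' (V.part i) ω)) * g σ)| ≤ 7 * δ * n := by
  have hn' : (0:ℝ) < n := by exact_mod_cast hn
  set m : Fin V.k → ℝ := fun i => expec μ (fun σ' => empDist σ' (V.part i) ω) with hm
  set T : Fin V.k → ℝ := fun i => expec μ (fun σ => tv (empDist σ (V.part i))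
                (fun ω => expec μ (fun σ' => empDist σ' (V.part i) ω))) with hT
  have h1 := part_bound hμ hδ V hV ω g hg
  have h2 : ∀ i, ∀ x ∈ V.part i, |expec μ (fun σ => (indX x ω σ - m i) * g σ)| ≤
      |expec μ (fun σ => (indX x ω σ - empDist σ (V.part i) ω) * g σ)| + 2 * T i := by
    intro i x _
    have e : expec μ (fun σ => (indX x ω σ - m i) * g σ) =
        expec μ (fun σ => (indX x ω σ - empDist σ (V.part i) ω) * g σ) +
        expec μ (fun σ => (empDist σ (V.part i) ω - m i) * g σ) := by
      rw [← expec_add]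
      congr 1; ext σ; ring
    rw [e]
    refine (abs_add_le _ _).trans (add_le_add le_rfl ?_)
    refine (abs_expec_mul_le hμ _ g hg).trans ?_
    rw [hT, ← expec_smul]
    exact expec_mono hμ fun σ => le_two_tv (empDist σ (V.part i))
      (fun ω => expec μ (fun σ' => empDist σ' (V.part i) ω)) ω
  have h3 : ∑ i, ((V.part i).card : ℝ) * T i ≤ δ * n := by
    have : ∑ i, ((V.part i).card : ℝ) * T i = n * ∑ i, ((V.part i).card : ℝ) / n * T i := by
      rw [Finset.mul_sum]
      refine Finset.sum_congr rfl fun i _ => ?_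
      field_simp
    rw [this, mul_comm δ]
    exact mul_le_mul_of_nonneg_left hc.le hn'.le
  refine (Finset.sum_le_sum fun i _ => Finset.sum_le_sum (h2 i)).trans ?_
  simp only [Finset.sum_add_distrib, Finset.sum_const, nsmul_eq_mul]
  have : ∑ i, ((V.part i).card : ℝ) * (2 * T i) = 2 * ∑ i, ((V.part i).card : ℝ) * T i := by
    rw [Finset.mul_sum]
    exact Finset.sum_congr rfl fun i _ => by ring
  linarith

theorem marg1_eq (μ : (Fin n → Ω) → ℝ) (x : Fin n) (ω : Ω) :
    marg1 μ x ω = expec μ (indX x ω) := by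
  unfold marg1 expec indX
  simp [Finset.sum_filter]

theorem margLaw_eq {k : ℕ} (μ : (Fin n → Ω) → ℝ) (xs : Fin k → Fin n) (τ : Fin k → Ω) :
    margLaw μ xs τ = expec μ (fun σ => ∏ i, indX (xs i) (τ i) σ) := by
  unfold margLaw expec indX
  rw [Finset.sum_filter]
  refine Finset.sum_congr rfl fun σ _ => ?_
  simp [Finset.prod_ite_zero]

theorem key_bound {μ : (Fin n → Ω) → ℝ} (hμ : IsPMF μ) (hn : 0 < n) {δ : ℝ} (hδ : 0 < δ)
    (V : FinPartition (Fin n)) (hV : regularPart δ μ V)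
    (hc : ∑ i : Fin V.k, ((V.part i).card : ℝ) / n *
              expec μ (fun σ => tv (empDist σ (V.part i))
                (fun ω => expec μ (fun σ' => empDist σ' (V.part i) ω))) < δ)
    (ω : Ω) (g : (Fin n → Ω) → ℝ) (hg : ∀ σ, |g σ| ≤ 1) :
    ∑ x, |expec μ (fun σ => (indX x ω σ - marg1 μ x ω) * g σ)| ≤ 14 * δ * n := by
  have h1 := mean_bound hμ hn hδ V hV hc ω g hg
  have h2 := mean_bound hμ hn hδ V hV hc ω (fun _ => 1) (by simp)
  rw [sum_parts V]
  have h3 : ∀ i, ∀ x ∈ V.part i, |expec μ (fun σ => (indX x ω σ - marg1 μ x ω) * g σ)| ≤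
      |expec μ (fun σ => (indX x ω σ - expec μ (fun σ' => empDist σ' (V.part i) ω)) * g σ)| +
      |expec μ (fun σ => (indX x ω σ - expec μ (fun σ' => empDist σ' (V.part i) ω)) * 1)| := by
    intro i x _
    set m := expec μ (fun σ' => empDist σ' (V.part i) ω)
    have e1 : expec μ (fun σ => (indX x ω σ - m) * 1) = marg1 μ x ω - m := by
      rw [marg1_eq]
      have := expec_add μ (indX x ω) (fun _ => -m)
      rw [expec_const hμ] at this
      simpa [sub_eq_add_neg] using this
    have e : expec μ (fun σ => (indX x ω σ - marg1 μ x ω) * g σ) =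
        expec μ (fun σ => (indX x ω σ - m) * g σ) +
        expec μ (fun σ => (m - marg1 μ x ω) * g σ) := by
      rw [← expec_add]
      congr 1; ext σ; ring
    rw [e, e1]
    refine (abs_add_le _ _).trans (add_le_add le_rfl ?_)
    refine (abs_expec_mul_le hμ _ g hg).trans ?_
    rw [expec_const hμ, abs_sub_comm]
  refine (Finset.sum_le_sum fun i _ => Finset.sum_le_sum (h3 i)).trans ?_
  simp only [Finset.sum_add_distrib]
  linarith

theorem marg1_abs {μ : (Fin n → Ω) → ℝ} (hμ : IsPMF μ) (x : Fin n) (ω : Ω) :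
    |marg1 μ x ω| ≤ 1 := by
  rw [marg1_eq, abs_le]
  have h1 := expec_mono hμ (f := fun _ => 0) (indX_nonneg x ω)
  have h2 := expec_mono hμ (g := fun _ => 1) (indX_le x ω)
  rw [expec_const hμ] at h1 h2
  constructor <;> linarith

theorem tele {μ : (Fin n → Ω) → ℝ} (hμ : IsPMF μ) {C : ℝ}
    (hkey : ∀ (ω : Ω) (g : (Fin n → Ω) → ℝ), (∀ σ, |g σ| ≤ 1) →
      ∑ x, |expec μ (fun σ => (indX x ω σ - marg1 μ x ω) * g σ)| ≤ C * n) (k : ℕ) :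
    ∀ τ : Fin k → Ω, ∑ xs : Fin k → Fin n,
      |expec μ (fun σ => ∏ i, indX (xs i) (τ i) σ) - ∏ i, marg1 μ (xs i) (τ i)|
        ≤ k * C * (n : ℝ) ^ k := by
  induction k with
  | zero =>
    intro τ
    simp [expec_const hμ]
  | succ k ih =>
    intro τ
    rw [← (Fin.consEquiv (fun _ : Fin (k+1) => Fin n)).sum_comp, Fintype.sum_prod_type_right]
    simp only [Fin.consEquiv_apply, Fin.prod_univ_succ, Fin.cons_zero, Fin.cons_succ]
    have hG : ∀ (ys : Fin k → Fin n) (σ : Fin n → Ω),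
        |∏ i, indX (ys i) (τ i.succ) σ| ≤ 1 := by
      intro ys σ
      rw [Finset.abs_prod]
      refine Finset.prod_le_one (fun _ _ => abs_nonneg _) fun i _ => ?_
      rw [abs_of_nonneg (indX_nonneg _ _ _)]
      exact indX_le _ _ _
    have step : ∀ ys : Fin k → Fin n,
        ∑ x : Fin n, |expec μ (fun σ => indX x (τ 0) σ * ∏ i, indX (ys i) (τ i.succ) σ) -
          marg1 μ x (τ 0) * ∏ i, marg1 μ (ys i) (τ i.succ)| ≤
        C * n + n * |expec μ (fun σ => ∏ i, indX (ys i) (τ i.succ) σ) -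
          ∏ i, marg1 μ (ys i) (τ i.succ)| := by
      intro ys
      have hx : ∀ x ∈ (univ : Finset (Fin n)),
          |expec μ (fun σ => indX x (τ 0) σ * ∏ i, indX (ys i) (τ i.succ) σ) -
          marg1 μ x (τ 0) * ∏ i, marg1 μ (ys i) (τ i.succ)| ≤
          |expec μ (fun σ => (indX x (τ 0) σ - marg1 μ x (τ 0)) *
            ∏ i, indX (ys i) (τ i.succ) σ)| +
          |expec μ (fun σ => ∏ i, indX (ys i) (τ i.succ) σ) -
          ∏ i, marg1 μ (ys i) (τ i.succ)| := by
        intro x _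
        have e : expec μ (fun σ => indX x (τ 0) σ * ∏ i, indX (ys i) (τ i.succ) σ) =
          expec μ (fun σ => (indX x (τ 0) σ - marg1 μ x (τ 0)) *
            ∏ i, indX (ys i) (τ i.succ) σ) +
          marg1 μ x (τ 0) * expec μ (fun σ => ∏ i, indX (ys i) (τ i.succ) σ) := by
          rw [← expec_smul, ← expec_add]
          congr 1; ext σ; ring
        rw [e, add_sub_assoc, ← mul_sub]
        refine (abs_add_le _ _).trans (add_le_add le_rfl ?_)
        rw [abs_mul]
        exact mul_le_of_le_one_left (abs_nonneg _) (marg1_abs hμ _ _)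
      refine (Finset.sum_le_sum hx).trans ?_
      rw [Finset.sum_add_distrib]
      refine add_le_add (hkey _ _ (hG ys)) ?_
      simp
    refine (Finset.sum_le_sum fun ys _ => step ys).trans ?_
    rw [Finset.sum_add_distrib]
    have := mul_le_mul_of_nonneg_left (ih (fun i => τ i.succ)) (Nat.cast_nonneg (α := ℝ) n)
    rw [Finset.mul_sum] at this
    simp only [Finset.sum_const, Finset.card_univ, Fintype.card_fun, Fintype.card_fin,
      nsmul_eq_mul]
    push_cast
    rw [pow_succ]
    nlinarith [this]

end

/-- Lemma: regularity plus concentrated class marginals imply symmetry. -/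
theorem stmt7 (k : ℕ) (hk : 2 ≤ k) (ε : ℝ) (hε : 0 < ε)
    (Ω : Type) [Fintype Ω] [DecidableEq Ω] (hΩ : 2 ≤ Fintype.card Ω) :
    ∃ δ : ℝ, 0 < δ ∧ ∃ n₀ : ℕ, ∀ n : ℕ, n₀ < n →
      ∀ μ : (Fin n → Ω) → ℝ, IsPMF μ →
        ∀ V : FinPartition (Fin n), regularPart δ μ V →
          (∑ i : Fin V.k, ((V.part i).card : ℝ) / n *
              expec μ (fun σ => tv (empDist σ (V.part i))
                (fun ω => expec μ (fun σ' => empDist σ' (V.part i) ω))) < δ) →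
          IsSymmetric ε k μ := by
  have hk0 : (0:ℝ) < k := by exact_mod_cast (by omega : 0 < k)
  have hQ : (0:ℝ) < (Fintype.card Ω : ℝ) ^ k := by
    have : (0:ℝ) < Fintype.card Ω := by exact_mod_cast (by omega : 0 < Fintype.card Ω)
    positivity
  refine ⟨ε / (14 * k * (Fintype.card Ω : ℝ) ^ k), by positivity, 0, ?_⟩
  intro n hn μ hμ V hV hc
  set δ := ε / (14 * k * (Fintype.card Ω : ℝ) ^ k) with hδd
  have hδ : 0 < δ := by positivity
  have hn' : (0:ℝ) < n := by exact_mod_cast hn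
  have ht := tele hμ (C := 14 * δ) (fun ω g hg => key_bound hμ hn hδ V hV hc ω g hg) k
  unfold IsSymmetric stateSum tv
  simp only [margLaw_eq]
  rw [← Finset.sum_div, Finset.sum_comm]
  have h2 := Finset.sum_le_sum fun τ (_ : τ ∈ (univ : Finset (Fin k → Ω))) => ht τ
  simp only [Finset.sum_const, Finset.card_univ, Fintype.card_fun, Fintype.card_fin,
      nsmul_eq_mul] at h2
  push_cast at h2
  have e : (Fintype.card Ω : ℝ) ^ k * (k * (14 * δ) * (n : ℝ) ^ k) = ε * (n : ℝ) ^ k := by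
    rw [hδd]; field_simp
  rw [e] at h2
  have hnk : (0:ℝ) < (n:ℝ) ^ k := by positivity
  rw [one_div, inv_mul_lt_iff₀ hnk]
  have : 0 < ε * (n:ℝ) ^ k := by positivity
  linarith

end
end

section
/- For every finite set Ω, every η ∈ (0,1), every n ∈ ℕ, every probability measure μ on Ω^n and every map p : [n] → P(Ω) the following holds. If (1/n²) Σ_{x,y∈[n]} ‖μ_↓(x,y) − p_x ⊗ p_y‖_TV < η², then (1/n) Σ_{x∈[n]} ‖μ_↓x − p_x‖_TV ≤ η²|Ω|, and moreover (1/n²) Σ_{x,y∈[n]} ‖μ_↓(x,y) − μ_↓x ⊗ μ_↓y‖_TV ≤ η²(1 + 2|Ω|). -/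
open Finset

noncomputable section

theorem aux_tv_triangle {X : Type*} [Fintype X] (a b c : X → ℝ) : tv a c ≤ tv a b + tv b c := by
  unfold tv
  rw [← add_div, ← Finset.sum_add_distrib]
  gcongr with x
  exact abs_sub_le _ _ _

theorem aux_tv_symm {X : Type*} [Fintype X] (a b : X → ℝ) : tv a b = tv b a := by
  unfold tv
  simp only [abs_sub_comm]

theorem aux_tv_nonneg {X : Type*} [Fintype X] (a b : X → ℝ) : 0 ≤ tv a b := by
  unfold tv
  positivity

theorem aux_tv_fst {Ω : Type*} [Fintype Ω] (q r : Ω × Ω → ℝ) :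
    tv (fun a => ∑ b, q (a, b)) (fun a => ∑ b, r (a, b)) ≤ tv q r := by
  unfold tv
  rw [Fintype.sum_prod_type]
  gcongr with a
  rw [← Finset.sum_sub_distrib]
  exact Finset.abs_sum_le_sum_abs _ _

theorem aux_marg {Ω : Type*} [Fintype Ω] [DecidableEq Ω] {n : ℕ} (μ : (Fin n → Ω) → ℝ)
    (x y : Fin n) : (fun a => ∑ b, pairLaw μ x y (a, b)) = marg1 μ x := by
  funext a
  unfold pairLaw marg1
  simp only [Finset.sum_filter]
  rw [Finset.sum_comm]
  refine Finset.sum_congr rfl fun σ _ => ?_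
  by_cases h : σ x = a <;> simp [h]

theorem aux_marg_pmf {Ω : Type*} [Fintype Ω] [DecidableEq Ω] {n : ℕ} (μ : (Fin n → Ω) → ℝ)
    (hμ : IsPMF μ) (x : Fin n) : IsPMF (marg1 μ x) := by
  refine ⟨fun a => Finset.sum_nonneg fun σ _ => hμ.1 σ, ?_⟩
  rw [← hμ.2]
  unfold marg1
  simp only [Finset.sum_filter]
  rw [Finset.sum_comm]
  simp

theorem aux_tv_mul {Ω : Type*} [Fintype Ω] (a b c d : Ω → ℝ) (hb : IsPMF b) (hc : IsPMF c) :
    tv (fun τ : Ω × Ω => a τ.1 * b τ.2) (fun τ : Ω × Ω => c τ.1 * d τ.2) ≤ tv a c + tv b d := by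
  refine (aux_tv_triangle _ (fun τ : Ω × Ω => c τ.1 * b τ.2) _).trans (le_of_eq ?_)
  unfold tv
  simp only [Fintype.sum_prod_type, ← sub_mul, ← mul_sub, abs_mul, abs_of_nonneg (hb.1 _),
    abs_of_nonneg (hc.1 _), ← Finset.mul_sum, ← Finset.sum_mul, hb.2, hc.2, mul_one, one_mul]

theorem stmt11 (Ω : Type) [Fintype Ω] [DecidableEq Ω] (hΩ : 2 ≤ Fintype.card Ω)
    (η : ℝ) (hη : 0 < η) (hη1 : η < 1) (n : ℕ)
    (μ : (Fin n → Ω) → ℝ) (hμ : IsPMF μ)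
    (p : Fin n → Ω → ℝ) (hp : ∀ x, IsPMF (p x))
    (h : (1 / (n : ℝ) ^ 2) * ∑ x : Fin n, ∑ y : Fin n,
        tv (pairLaw μ x y) (fun τ : Ω × Ω => p x τ.1 * p y τ.2) < η ^ 2) :
    (1 / (n : ℝ)) * ∑ x : Fin n, tv (marg1 μ x) (p x) ≤ η ^ 2 * (Fintype.card Ω : ℝ) ∧
    (1 / (n : ℝ) ^ 2) * ∑ x : Fin n, ∑ y : Fin n,
        tv (pairLaw μ x y) (fun τ : Ω × Ω => marg1 μ x τ.1 * marg1 μ y τ.2)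
      ≤ η ^ 2 * (1 + 2 * (Fintype.card Ω : ℝ)) := by
  have hc : (2 : ℝ) ≤ (Fintype.card Ω : ℝ) := by exact_mod_cast hΩ
  have hη2 : 0 < η ^ 2 := by positivity
  rcases Nat.eq_zero_or_pos n with rfl | hn
  · simp
    constructor <;> positivity
  have hn' : (0 : ℝ) < n := by exact_mod_cast hn
  set T := ∑ x : Fin n, ∑ y : Fin n,
        tv (pairLaw μ x y) (fun τ : Ω × Ω => p x τ.1 * p y τ.2) with hT
  set D := ∑ x : Fin n, tv (marg1 μ x) (p x) with hD
  have h1 : ∀ x y, tv (marg1 μ x) (p x)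
      ≤ tv (pairLaw μ x y) (fun τ : Ω × Ω => p x τ.1 * p y τ.2) := by
    intro x y
    have := aux_tv_fst (pairLaw μ x y) (fun τ : Ω × Ω => p x τ.1 * p y τ.2)
    rw [aux_marg] at this
    simpa only [← Finset.mul_sum, (hp y).2, mul_one] using this
  have h2 : n * D ≤ T := by
    rw [hD, hT, Finset.mul_sum]
    refine Finset.sum_le_sum fun x _ => ?_
    calc (n : ℝ) * tv (marg1 μ x) (p x) = ∑ y : Fin n, tv (marg1 μ x) (p x) := by simp
      _ ≤ _ := Finset.sum_le_sum fun y _ => h1 x y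
  have h3 : ∑ x : Fin n, ∑ y : Fin n,
        tv (pairLaw μ x y) (fun τ : Ω × Ω => marg1 μ x τ.1 * marg1 μ y τ.2)
        ≤ T + 2 * (n * D) := by
    have e : T + 2 * (n * D) = ∑ x : Fin n, ∑ y : Fin n,
        (tv (pairLaw μ x y) (fun τ : Ω × Ω => p x τ.1 * p y τ.2)
          + (tv (marg1 μ x) (p x) + tv (marg1 μ y) (p y))) := by
      simp only [Finset.sum_add_distrib, ← hT, ← hD, Finset.sum_const, Finset.card_univ,
        Fintype.card_fin, nsmul_eq_mul, ← Finset.mul_sum]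
      ring
    rw [e]
    refine Finset.sum_le_sum fun x _ => Finset.sum_le_sum fun y _ => ?_
    refine (aux_tv_triangle _ (fun τ : Ω × Ω => p x τ.1 * p y τ.2) _).trans ?_
    gcongr
    rw [aux_tv_symm]
    exact aux_tv_mul _ _ _ _ (aux_marg_pmf μ hμ y) (hp x)
  have hT' : T < η ^ 2 * n ^ 2 := by
    rw [one_div, inv_mul_eq_div, div_lt_iff₀ (by positivity)] at h
    exact h
  constructor
  · rw [one_div, inv_mul_eq_div, div_le_iff₀ hn']
    have : D ≤ η ^ 2 * n := by
      refine le_of_mul_le_mul_left ?_ hn'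
      nlinarith
    have h5 : η ^ 2 * n * 1 ≤ η ^ 2 * n * (Fintype.card Ω : ℝ) := by gcongr; linarith
    linarith
  · rw [one_div, inv_mul_eq_div, div_le_iff₀ (by positivity)]
    have h5 : η ^ 2 * n ^ 2 * 1 ≤ η ^ 2 * n ^ 2 * (Fintype.card Ω : ℝ) := by gcongr; linarith
    linarith
end
end
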